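/- Let α ∈ (0,1), a < b reals, let A be a real symmetric d×d matrix with eigenvalues λ₁,…,λ_d and set λ_max = max_i |λ_i| (equivalently, the operator norm of A), let M ≥ 0 and let g : [a,b] → ℝ be continuous with |g(t)| ≤ M for all t. If Ψ : [a,b] → ℝ^{d×d} is continuous and satisfies Ψ(t) = 𝕀 + (1/Γ(α)) ∫_a^t (t−s)^{α−1} g(s) A Ψ(s) ds for all t ∈ [a,b], then for every t ∈ [a,b]: E_α(−λ_max M (b−a)^α) ≤ ‖Ψ(t)‖ ≤ E_α(λ_max M (b−a)^α), where ‖·‖ is the operator norm induced by the Euclidean norm. -/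

import Mathlib

open MeasureTheory Set Matrix

attribute [local instance] Matrix.normedAddCommGroup Matrix.normedSpace

/-- The one-parameter Mittag-Leffler function `E_α(x) = Σ_{k=0}^∞ x^k / Γ(αk+1)`. -/
noncomputable def mittagLeffler (α x : ℝ) : ℝ :=
  ∑' k : ℕ, x ^ k / Real.Gamma (α * k + 1)

open Filter Topology

/-- The Riemann–Liouville kernel `t ↦ t^(β-1) / Γ(β)`, extended by zero to `t ≤ 0`. -/
noncomputable def fracKernel (β t : ℝ) : ℝ :=
  if 0 < t then t ^ (β - 1) / Real.Gamma β else 0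

/-- The two-parameter Mittag-Leffler function. -/
noncomputable def mittagLeffler₂ (α β x : ℝ) : ℝ :=
  ∑' k : ℕ, x ^ k / Real.Gamma (α * k + β)

/-- The kernel `t ↦ t^(β-1) E_{α,β}(c t^α)`, extended by zero to `t ≤ 0`. -/
noncomputable def mlKernel (α c β t : ℝ) : ℝ :=
  if 0 < t then t ^ (β - 1) * mittagLeffler₂ α β (c * t ^ α) else 0

lemma fracKernel_of_pos {β t : ℝ} (ht : 0 < t) :
    fracKernel β t = t ^ (β - 1) / Real.Gamma β := if_pos ht

lemma fracKernel_of_nonpos {β t : ℝ} (ht : t ≤ 0) : fracKernel β t = 0 := if_neg ht.not_gt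

lemma fracKernel_pos {β t : ℝ} (hβ : 0 < β) (ht : 0 < t) : 0 < fracKernel β t := by
  rw [fracKernel_of_pos ht]
  exact div_pos (Real.rpow_pos_of_pos ht _) (Real.Gamma_pos_of_pos hβ)

lemma fracKernel_nonneg {β : ℝ} (hβ : 0 < β) (t : ℝ) : 0 ≤ fracKernel β t := by
  rcases le_or_gt t 0 with ht | ht
  · exact (fracKernel_of_nonpos ht).ge
  · exact (fracKernel_pos hβ ht).le

lemma fracKernel_one_of_pos {t : ℝ} (ht : 0 < t) : fracKernel 1 t = 1 := by
  simp [fracKernel_of_pos ht]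

lemma measurable_fracKernel (β : ℝ) : Measurable (fracKernel β) :=
  Measurable.ite measurableSet_Ioi ((measurable_id.pow_const _).div_const _) measurable_const

lemma integral_fracKernel_mul_fracKernel {β γ : ℝ} (hβ : 0 < β) (hγ : 0 < γ) (t : ℝ) :
    ∫ s, fracKernel β (t - s) * fracKernel γ s = fracKernel (β + γ) t := by
  rcases le_or_gt t 0 with ht | ht
  · rw [fracKernel_of_nonpos ht]
    refine integral_eq_zero_of_ae (ae_of_all _ fun s => ?_)
    rcases le_or_gt s 0 with hs | hs
    · simp [fracKernel_of_nonpos hs]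
    · simp [fracKernel_of_nonpos (show t - s ≤ 0 by linarith)]
  have hset : ∫ s, fracKernel β (t - s) * fracKernel γ s =
      ∫ s in (0 : ℝ)..t, fracKernel β (t - s) * fracKernel γ s := by
    rw [intervalIntegral.integral_of_le ht.le, setIntegral_eq_integral_of_forall_compl_eq_zero]
    intro s hs
    rcases le_or_gt s 0 with hs0 | hs0
    · simp [fracKernel_of_nonpos hs0]
    · have : t < s := by
        by_contra h
        exact hs ⟨hs0, not_lt.1 h⟩
      simp [fracKernel_of_nonpos (show t - s ≤ 0 by linarith)]
  have hβγ := Real.Gamma_pos_of_pos (add_pos hβ hγ)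
  have hbeta := Complex.betaIntegral_scaled γ β ht
  rw [Complex.betaIntegral_eq_Gamma_mul_div γ β (by simpa) (by simpa)] at hbeta
  have hcast : ((∫ s in (0 : ℝ)..t, s ^ (γ - 1) * (t - s) ^ (β - 1) : ℝ) : ℂ) =
      ∫ s in (0 : ℝ)..t, (s : ℂ) ^ ((γ : ℂ) - 1) * ((t : ℂ) - s) ^ ((β : ℂ) - 1) := by
    rw [← intervalIntegral.integral_ofReal]
    refine intervalIntegral.integral_congr fun s hs => ?_
    rw [uIcc_of_le ht.le] at hs
    push_cast [Complex.ofReal_cpow hs.1, Complex.ofReal_cpow (sub_nonneg.2 hs.2)]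
    rfl
  rw [← hcast] at hbeta
  have hreal : ∫ s in (0 : ℝ)..t, s ^ (γ - 1) * (t - s) ^ (β - 1) =
      t ^ (γ + β - 1) * (Real.Gamma γ * Real.Gamma β / Real.Gamma (γ + β)) := by
    apply Complex.ofReal_injective
    rw [hbeta]
    push_cast [Complex.ofReal_cpow ht.le, Complex.Gamma_ofReal]
    rw [← Complex.Gamma_ofReal, ← Complex.Gamma_ofReal, ← Complex.Gamma_ofReal]
    push_cast
    rfl
  have hcongr : ∫ s in (0 : ℝ)..t, fracKernel β (t - s) * fracKernel γ s =
      ∫ s in (0 : ℝ)..t, (Real.Gamma γ * Real.Gamma β)⁻¹ * (s ^ (γ - 1) * (t - s) ^ (β - 1)) := by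
    rw [intervalIntegral.integral_of_le ht.le, intervalIntegral.integral_of_le ht.le,
      integral_Ioc_eq_integral_Ioo, integral_Ioc_eq_integral_Ioo]
    refine setIntegral_congr_fun measurableSet_Ioo fun s hs => ?_
    simp only [fracKernel_of_pos hs.1, fracKernel_of_pos (sub_pos.2 hs.2)]
    field_simp
  rw [hset, hcongr, intervalIntegral.integral_const_mul, hreal, fracKernel_of_pos ht,
    add_comm γ β]
  have h1 := (Real.Gamma_pos_of_pos hβ).ne'
  have h2 := (Real.Gamma_pos_of_pos hγ).ne'
  field_simp

lemma integrable_fracKernel_mul_fracKernel {β γ : ℝ} (hβ : 0 < β) (hγ : 0 < γ) (t : ℝ) :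
    Integrable fun s => fracKernel β (t - s) * fracKernel γ s := by
  rcases le_or_gt t 0 with ht | ht
  · convert! integrable_zero ℝ ℝ volume using 1
    ext s
    rcases le_or_gt s 0 with hs | hs
    · simp [fracKernel_of_nonpos hs]
    · simp [fracKernel_of_nonpos (show t - s ≤ 0 by linarith)]
  · by_contra h
    have := integral_fracKernel_mul_fracKernel hβ hγ t
    rw [integral_undef h] at this
    exact (fracKernel_pos (add_pos hβ hγ) ht).ne this

lemma rpow_mul_exp_neg_le_Gamma {x R : ℝ} (hx : 0 < x) (hR : 0 < R) :
    R ^ x * (Real.exp (-(R + 1)) / (R + 1)) ≤ Real.Gamma x := by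
  rw [Real.Gamma_eq_integral hx]
  have hinteg := Real.GammaIntegral_convergent hx
  have hsub : Ioc R (R + 1) ⊆ Ioi 0 := fun s hs => hR.trans hs.1
  calc R ^ x * (Real.exp (-(R + 1)) / (R + 1))
      = ∫ _ in Ioc R (R + 1), R ^ x * (Real.exp (-(R + 1)) / (R + 1)) := by simp
    _ ≤ ∫ s in Ioc R (R + 1), Real.exp (-s) * s ^ (x - 1) := by
        refine setIntegral_mono_on (integrable_const _) (hinteg.mono_set hsub) measurableSet_Ioc
          fun s hs => ?_
        have hs0 : 0 < s := hR.trans hs.1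
        rw [Real.rpow_sub_one hs0.ne', mul_div_assoc', mul_comm (R ^ x), mul_div_assoc']
        have h1 : R ^ x ≤ s ^ x := Real.rpow_le_rpow hR.le hs.1.le hx.le
        have h2 : Real.exp (-(R + 1)) ≤ Real.exp (-s) := Real.exp_le_exp.2 (by linarith [hs.2])
        have h3 : s ≤ R + 1 := hs.2
        have h4 : 0 ≤ s ^ x := Real.rpow_nonneg hs0.le _
        gcongr
    _ ≤ _ := setIntegral_mono_set hinteg
        ((ae_restrict_mem measurableSet_Ioi).mono fun s hs =>
          mul_nonneg (Real.exp_pos _).le (Real.rpow_nonneg (le_of_lt hs) _))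
        hsub.eventuallyLE

lemma summable_pow_div_Gamma {α β : ℝ} (hα : 0 < α) (hβ : 0 < β) (x : ℝ) :
    Summable fun k : ℕ => x ^ k / Real.Gamma (α * k + β) := by
  obtain ⟨R, hR0, hR⟩ : ∃ R : ℝ, 0 < R ∧ R ^ α = 2 * (|x| + 1) :=
    ⟨(2 * (|x| + 1)) ^ α⁻¹, by positivity, Real.rpow_inv_rpow (by positivity) hα.ne'⟩
  have hC : 0 < R ^ β * (Real.exp (-(R + 1)) / (R + 1)) := by positivity
  refine Summable.of_norm_bounded (g := fun k : ℕ =>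
    (R ^ β * (Real.exp (-(R + 1)) / (R + 1)))⁻¹ * (1 / 2) ^ k)
    (summable_geometric_two.mul_left _) fun k => ?_
  have hk : 0 < α * k + β := by positivity
  have hG := rpow_mul_exp_neg_le_Gamma hk hR0
  rw [Real.rpow_add hR0, Real.rpow_mul_natCast hR0.le, hR] at hG
  rw [norm_div, norm_pow, Real.norm_eq_abs, Real.norm_of_nonneg (Real.Gamma_pos_of_pos hk).le,
    div_le_iff₀ (Real.Gamma_pos_of_pos hk)]
  have h1 : |x| ^ k ≤ (|x| + 1) ^ k := pow_le_pow_left₀ (abs_nonneg x) (by linarith) k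
  calc |x| ^ k ≤ (|x| + 1) ^ k := h1
    _ = (R ^ β * (Real.exp (-(R + 1)) / (R + 1)))⁻¹ * (1 / 2) ^ k *
        ((2 * (|x| + 1)) ^ k * R ^ β * (Real.exp (-(R + 1)) / (R + 1))) := by
          rw [mul_pow, mul_assoc ((2 : ℝ) ^ k * _), mul_comm ((2 : ℝ) ^ k * _),
            one_div, inv_pow]
          field_simp
    _ ≤ _ := by gcongr

lemma continuous_mittagLeffler₂ {α β : ℝ} (hα : 0 < α) (hβ : 0 < β) :
    Continuous (mittagLeffler₂ α β) := by
  rw [continuous_iff_continuousAt]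
  intro x
  have hB : ContinuousOn (mittagLeffler₂ α β) (Ioo (-(|x| + 1)) (|x| + 1)) := by
    refine continuousOn_tsum (fun k => by fun_prop)
      (summable_pow_div_Gamma hα hβ (|x| + 1)) fun k y hy => ?_
    have hk := Real.Gamma_pos_of_pos (show 0 < α * k + β by positivity)
    rw [norm_div, norm_pow, Real.norm_eq_abs, Real.norm_of_nonneg hk.le]
    have : |y| ≤ |x| + 1 := abs_le.2 ⟨hy.1.le, hy.2.le⟩
    gcongr
  exact hB.continuousAt (Ioo_mem_nhds (by linarith [neg_abs_le x]) (by linarith [le_abs_self x]))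

lemma mlKernel_of_nonpos {α c β t : ℝ} (ht : t ≤ 0) : mlKernel α c β t = 0 := if_neg ht.not_gt

lemma mlKernel_of_pos {α c β t : ℝ} (ht : 0 < t) :
    mlKernel α c β t = t ^ (β - 1) * mittagLeffler₂ α β (c * t ^ α) := if_pos ht

lemma mlKernel_one_of_pos {α c t : ℝ} (ht : 0 < t) :
    mlKernel α c 1 t = mittagLeffler α (c * t ^ α) := by
  simp [mlKernel_of_pos ht, mittagLeffler₂, mittagLeffler]

lemma hasSum_mlKernel {α β : ℝ} (hα : 0 < α) (hβ : 0 < β) (c t : ℝ) :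
    HasSum (fun k : ℕ => c ^ k * fracKernel (α * k + β) t) (mlKernel α c β t) := by
  rcases le_or_gt t 0 with ht | ht
  · simp [fracKernel_of_nonpos ht, mlKernel_of_nonpos ht]
  · rw [mlKernel_of_pos ht]
    convert! (summable_pow_div_Gamma hα hβ (c * t ^ α)).hasSum.mul_left (t ^ (β - 1)) using 2 with k
    rw [fracKernel_of_pos ht, mul_pow, ← Real.rpow_mul_natCast ht.le, add_sub_assoc,
      Real.rpow_add ht]
    ring

lemma mlKernel_eq_add {α β : ℝ} (hα : 0 < α) (hβ : 0 < β) (c t : ℝ) :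
    mlKernel α c β t = fracKernel β t + c * mlKernel α c (β + α) t := by
  have h := hasSum_mlKernel hα hβ c t
  rw [← h.tsum_eq, h.summable.tsum_eq_zero_add,
    ← (hasSum_mlKernel hα (add_pos hβ hα) c t).tsum_eq, ← tsum_mul_left]
  simp only [pow_zero, Nat.cast_zero, mul_zero, zero_add, one_mul]
  congr 1
  refine tsum_congr fun k => ?_
  rw [pow_succ']
  push_cast
  rw [show α * ((k : ℝ) + 1) + β = α * k + (β + α) by ring, mul_assoc]

lemma measurable_mlKernel {α β : ℝ} (hα : 0 < α) (hβ : 0 < β) (c : ℝ) :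
    Measurable (mlKernel α c β) :=
  Measurable.ite measurableSet_Ioi ((measurable_id.pow_const _).mul
    ((continuous_mittagLeffler₂ hα hβ).measurable.comp ((measurable_id.pow_const _).const_mul _)))
    measurable_const

lemma abs_mlKernel_le {α β : ℝ} (hα : 0 < α) (hβ : 0 < β) (c t : ℝ) :
    |mlKernel α c β t| ≤ mlKernel α |c| β t := by
  rw [← (hasSum_mlKernel hα hβ |c| t).tsum_eq, ← (hasSum_mlKernel hα hβ c t).tsum_eq]
  have h : ∀ k : ℕ, ‖c ^ k * fracKernel (α * k + β) t‖ = |c| ^ k * fracKernel (α * k + β) t := by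
    intro k
    rw [norm_mul, norm_pow, Real.norm_eq_abs,
      Real.norm_of_nonneg (fracKernel_nonneg (by positivity) t)]
  have hs : Summable fun k : ℕ => ‖c ^ k * fracKernel (α * k + β) t‖ := by
    simpa only [h] using (hasSum_mlKernel hα hβ |c| t).summable
  exact (norm_tsum_le_tsum_norm hs).trans (by simp only [h]; exact le_rfl)

lemma integral_fracKernel_mul_mlKernel {α β γ : ℝ} (hα : 0 < α) (hβ : 0 < β) (hγ : 0 < γ)
    (c t : ℝ) :
    Integrable (fun s => fracKernel γ (t - s) * mlKernel α c β s) ∧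
      ∫ s, fracKernel γ (t - s) * mlKernel α c β s = mlKernel α c (β + γ) t := by
  set F : ℝ → ℕ → ℝ → ℝ := fun e k s => e ^ k * (fracKernel γ (t - s) * fracKernel (α * k + β) s)
  have hk : ∀ k : ℕ, 0 < α * k + β := fun k => by positivity
  have hF : ∀ e k, Integrable (F e k) := fun e k =>
    (integrable_fracKernel_mul_fracKernel hγ (hk k) t).const_mul _
  have hFi : ∀ e k, ∫ s, F e k s = e ^ k * fracKernel (α * k + (β + γ)) t := by
    intro e k
    simp only [F]
    rw [integral_const_mul, integral_fracKernel_mul_fracKernel hγ (hk k)]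
    congr 2
    ring
  have hnorm : ∀ e k s, ‖F e k s‖ = F |e| k s := by
    intro e k s
    simp only [F]
    rw [norm_mul, norm_pow, Real.norm_eq_abs, Real.norm_of_nonneg
      (mul_nonneg (fracKernel_nonneg hγ _) (fracKernel_nonneg (hk k) _))]
  have hsum : Summable fun k => ∫ s, ‖F c k s‖ := by
    simp only [hnorm, hFi]
    exact (hasSum_mlKernel hα (add_pos hβ hγ) |c| t).summable
  have htsum : ∀ e s, HasSum (fun k => F e k s) (fracKernel γ (t - s) * mlKernel α e β s) := by
    intro e s
    convert! (hasSum_mlKernel hα hβ e s).mul_left (fracKernel γ (t - s)) using 2 with k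
    simp only [F]
    ring
  have hval : ∀ e, |e| = |c| →
      ∫ s, fracKernel γ (t - s) * mlKernel α e β s = mlKernel α e (β + γ) t := by
    intro e he
    have h := hasSum_integral_of_summable_integral_norm (hF e) (by
      simpa only [hnorm, he] using hsum)
    simp only [hFi, (htsum e _).tsum_eq] at h
    exact h.unique (hasSum_mlKernel hα (add_pos hβ hγ) e t)
  refine ⟨?_, hval c rfl⟩
  rcases le_or_gt t 0 with ht | ht
  · convert! integrable_zero ℝ ℝ volume using 1
    ext s
    rcases le_or_gt s 0 with hs | hs
    · simp [mlKernel_of_nonpos hs]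
    · simp [fracKernel_of_nonpos (show t - s ≤ 0 by linarith)]
  have habs : Integrable (fun s => fracKernel γ (t - s) * mlKernel α |c| β s) := by
    by_contra h
    have h0 := hval |c| (abs_abs c)
    rw [integral_undef h] at h0
    have h1 := mlKernel_eq_add hα (add_pos hβ hγ) |c| t
    have h2 := fracKernel_pos (add_pos hβ hγ) ht
    have h3 := (abs_nonneg _).trans (abs_mlKernel_le hα (add_pos (add_pos hβ hγ) hα) c t)
    have h4 := mul_nonneg (abs_nonneg c) h3
    linarith
  refine habs.mono' (((measurable_fracKernel γ).comp (measurable_const.sub measurable_id)).mul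
    (measurable_mlKernel hα hβ c)).aestronglyMeasurable (ae_of_all _ fun s => ?_)
  rw [norm_mul, Real.norm_of_nonneg (fracKernel_nonneg hγ _)]
  exact mul_le_mul_of_nonneg_left (abs_mlKernel_le hα hβ c s) (fracKernel_nonneg hγ _)

lemma integral_mlKernel_mul_fracKernel {α β γ : ℝ} (hα : 0 < α) (hβ : 0 < β) (hγ : 0 < γ)
    (c t : ℝ) :
    Integrable (fun s => mlKernel α c β (t - s) * fracKernel γ s) ∧
      ∫ s, mlKernel α c β (t - s) * fracKernel γ s = mlKernel α c (β + γ) t := by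
  have h := integral_fracKernel_mul_mlKernel hα hβ hγ c t
  constructor
  · refine (h.1.comp_sub_left t).congr (ae_of_all _ fun s => ?_)
    simp [mul_comm]
  · rw [← h.2, ← integral_sub_left_eq_self _ volume t]
    simp [mul_comm]

lemma exists_first_zero {f : ℝ → ℝ} {T : ℝ} (hT : 0 ≤ T) (hf : ContinuousOn f (Icc 0 T))
    (h0 : 0 < f 0) (hfT : f T ≤ 0) :
    ∃ t ∈ Ioc 0 T, f t = 0 ∧ ∀ s ∈ Ico 0 t, 0 < f s := by
  have hclosed : IsClosed (Icc 0 T ∩ f ⁻¹' Iic 0) := hf.preimage_isClosed_of_isClosed isClosed_Icc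
    isClosed_Iic
  have hbdd : BddBelow (Icc 0 T ∩ f ⁻¹' Iic 0) := ⟨0, fun x hx => hx.1.1⟩
  have hmem := hclosed.csInf_mem ⟨T, ⟨hT, le_rfl⟩, hfT⟩ hbdd
  set t := sInf (Icc 0 T ∩ f ⁻¹' Iic 0)
  obtain ⟨z, hz, hfz⟩ := intermediate_value_Icc' hmem.1.1
    (hf.mono (Icc_subset_Icc_right hmem.1.2)) ⟨hmem.2, h0.le⟩
  have hzt : z = t := le_antisymm hz.2
    (csInf_le hbdd ⟨⟨hz.1, hz.2.trans hmem.1.2⟩, hfz.le⟩)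
  rw [hzt] at hfz
  refine ⟨t, ⟨hmem.1.1.lt_of_ne fun h => ?_, hmem.1.2⟩, hfz, fun s hs => ?_⟩
  · rw [← h] at hfz
    exact h0.ne' hfz
  · by_contra hle
    exact absurd (csInf_le hbdd ⟨⟨hs.1, hs.2.le.trans hmem.1.2⟩, not_lt.1 hle⟩) (not_le.2 hs.2)

lemma tendsto_fracKernel_nhds_zero {β : ℝ} (hβ : 1 < β) :
    Tendsto (fracKernel β) (𝓝[>] 0) (𝓝 0) := by
  have h : Tendsto (fun t : ℝ => t ^ (β - 1) / Real.Gamma β) (𝓝[>] 0) (𝓝 0) := by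
    have := ((Real.continuousAt_rpow_const 0 (β - 1) (Or.inr (by linarith))).div_const
      (Real.Gamma β)).tendsto.mono_left (nhdsWithin_le_nhds (s := Ioi 0))
    simpa [Real.zero_rpow (by linarith : β - 1 ≠ 0)] using this
  exact h.congr' (eventually_nhdsWithin_of_forall fun t ht => (fracKernel_of_pos ht).symm)

/-- Log-convexity of `t ↦ t^(α-1)`: ratios of shifted kernels are largest at zero shift. -/
lemma fracKernel_sub_le {α t₀ t₁ s : ℝ} (hα0 : 0 < α) (hα1 : α ≤ 1) (hs0 : 0 ≤ s) (hs : s < t₀)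
    (ht : t₀ ≤ t₁) :
    fracKernel α (t₁ - s) ≤ (t₁ / t₀) ^ (α - 1) * fracKernel α (t₀ - s) := by
  have ht0 : 0 < t₀ := hs0.trans_lt hs
  have hG := Real.Gamma_pos_of_pos hα0
  rw [fracKernel_of_pos (by linarith), fracKernel_of_pos (by linarith), mul_div_assoc',
    ← Real.mul_rpow (div_nonneg (by linarith) ht0.le) (by linarith)]
  refine div_le_div_of_nonneg_right ?_ hG.le
  have h1 : 0 < t₁ / t₀ := div_pos (by linarith) ht0
  refine Real.rpow_le_rpow_of_nonpos (mul_pos h1 (by linarith)) ?_ (by linarith)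
  rw [div_mul_eq_mul_div, div_le_iff₀ ht0]
  nlinarith

lemma integral_fracKernel_mul_fracKernel_shift {β γ : ℝ} (hβ : 0 < β) (hγ : 0 < γ) (t₀ t : ℝ) :
    Integrable (fun s => fracKernel β (t - s) * fracKernel γ (s - t₀)) ∧
      ∫ s, fracKernel β (t - s) * fracKernel γ (s - t₀) = fracKernel (β + γ) (t - t₀) := by
  have hfun : (fun s => fracKernel β (t - s) * fracKernel γ (s - t₀)) =
      fun s => (fun s => fracKernel β (t - t₀ - s) * fracKernel γ s) (s - t₀) := by
    ext s
    simp
  rw [hfun]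
  refine ⟨(integrable_fracKernel_mul_fracKernel hβ hγ _).comp_sub_right t₀, ?_⟩
  rw [integral_sub_right_eq_self (fun s => fracKernel β (t - t₀ - s) * fracKernel γ s) t₀,
    integral_fracKernel_mul_fracKernel hβ hγ]

/-- Positivity of the resolvent kernel of the fractional integral. -/
lemma mlKernel_neg_pos {α L t : ℝ} (hα0 : 0 < α) (hα1 : α ≤ 1) (hL : 0 ≤ L) (ht : 0 < t) :
    0 < mlKernel α (-L) α t := by
  by_contra hneg
  have hcont : Continuous fun s : ℝ => mittagLeffler₂ α α (-L * s ^ α) :=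
    (continuous_mittagLeffler₂ hα0 hα0).comp
      (continuous_const.mul (Real.continuous_rpow_const hα0.le))
  have hzero : mittagLeffler₂ α α (-L * (0 : ℝ) ^ α) = (Real.Gamma α)⁻¹ := by
    rw [Real.zero_rpow hα0.ne', mul_zero, mittagLeffler₂, tsum_eq_single 0]
    · simp
    · intro k hk
      simp [hk]
  have hsign : ∀ s, 0 < s → mlKernel α (-L) α s = s ^ (α - 1) * mittagLeffler₂ α α (-L * s ^ α) :=
    fun s hs => mlKernel_of_pos hs
  obtain ⟨t₁, ht₁, hz, hpos⟩ := exists_first_zero (f := fun s => mittagLeffler₂ α α (-L * s ^ α))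
    ht.le hcont.continuousOn (by
      simp only [hzero]
      exact inv_pos.2 (Real.Gamma_pos_of_pos hα0)) (by
      by_contra h
      rw [hsign t ht] at hneg
      exact hneg (mul_pos (Real.rpow_pos_of_pos ht _) (not_le.1 h)))
  have ht₁0 : 0 < t₁ := ht₁.1
  set r := mlKernel α (-L) α
  have hr_pos : ∀ s, 0 < s → s < t₁ → 0 < r s := fun s hs hs1 => by
    rw [hsign s hs]
    exact mul_pos (Real.rpow_pos_of_pos hs _) (hpos s ⟨hs.le, hs1⟩)
  have hr_zero : r t₁ = 0 := by
    rw [hsign t₁ ht₁0]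
    exact mul_eq_zero_of_right _ hz
  have hr_cont : ContinuousOn r (Ioi 0) := by
    refine ContinuousOn.congr (f := fun s => s ^ (α - 1) * mittagLeffler₂ α α (-L * s ^ α)) ?_ hsign
    exact (continuousOn_id.rpow_const fun x hx => Or.inl (ne_of_gt hx)).mul hcont.continuousOn
  have hr_eq : ∀ s, r s = fracKernel α s - L * ∫ x, fracKernel α (s - x) * r x := by
    intro s
    rw [(integral_fracKernel_mul_mlKernel hα0 hα0 hα0 (-L) s).2]
    have := mlKernel_eq_add hα0 hα0 (-L) s
    simp only [r]
    linarith
  -- a point `a < t₁` close enough to `t₁`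
  obtain ⟨a, ha1, ha2, haK⟩ : ∃ a, t₁ / 2 ≤ a ∧ a < t₁ ∧
      ∀ s ∈ Ico a t₁, L * fracKernel (α + 1) (t₁ - s) < 1 / 2 := by
    have h1 : Tendsto (fun s => L * fracKernel (α + 1) s) (𝓝[>] 0) (𝓝 0) := by
      simpa using (tendsto_fracKernel_nhds_zero (show 1 < α + 1 by linarith)).const_mul L
    have h2 := h1.eventually (gt_mem_nhds (show (0 : ℝ) < 1 / 2 by norm_num))
    obtain ⟨ε, hε, hε'⟩ := mem_nhdsGT_iff_exists_Ioc_subset.1 h2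
    refine ⟨max (t₁ / 2) (t₁ - ε), le_max_left _ _,
      max_lt (by linarith) (by linarith [show 0 < ε from hε]), fun s hs => ?_⟩
    have h3 := (max_le_iff.1 hs.1).2
    exact hε' ⟨by linarith [hs.2], by linarith⟩
  have ha0 : 0 < a := by linarith
  obtain ⟨t₀, ht₀, hmax⟩ := isCompact_Icc.exists_isMaxOn (nonempty_Icc.2 ha2.le)
    (hr_cont.mono (fun s hs => ha0.trans_le hs.1 : Icc a t₁ ⊆ Ioi 0))
  have hrt₀ : 0 < r t₀ := (hr_pos a ha0 ha2).trans_le (hmax ⟨le_rfl, ha2.le⟩)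
  have ht₀1 : t₀ < t₁ := ht₀.2.lt_of_ne fun h => by
    rw [h, hr_zero] at hrt₀
    exact hrt₀.false
  have ht₀0 : 0 < t₀ := ha0.trans_le ht₀.1
  set θ := (t₁ / t₀) ^ (α - 1) with hθ
  have hθ2 : 1 / 2 ≤ θ := by
    have h1 : t₁ / t₀ ≤ 2 := by
      rw [div_le_iff₀ ht₀0]
      linarith [ht₀.1]
    have h2 : 1 ≤ t₁ / t₀ := (one_le_div ht₀0).2 ht₀1.le
    calc (1 : ℝ) / 2 = 2 ^ (-1 : ℝ) := by norm_num [Real.rpow_neg_one]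
      _ ≤ 2 ^ (α - 1) := Real.rpow_le_rpow_of_exponent_le one_le_two (by linarith)
      _ ≤ θ := Real.rpow_le_rpow_of_nonpos (by linarith) h1 (by linarith)
  have hkθ : fracKernel α t₁ = θ * fracKernel α t₀ := by
    rw [fracKernel_of_pos ht₁0, fracKernel_of_pos ht₀0, mul_div_assoc', hθ,
      ← Real.mul_rpow (by positivity) ht₀0.le, div_mul_cancel₀ _ ht₀0.ne']
  have hinteg := fun t => (integral_fracKernel_mul_mlKernel hα0 hα0 hα0 (-L) t).1
  have hshift := integral_fracKernel_mul_fracKernel_shift hα0 one_pos t₀ t₁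
  have hle : (∫ x, fracKernel α (t₁ - x) * r x) - θ * ∫ x, fracKernel α (t₀ - x) * r x ≤
      r t₀ * fracKernel (α + 1) (t₁ - t₀) := by
    rw [← hshift.2, ← integral_const_mul, ← integral_const_mul,
      ← integral_sub (hinteg t₁) ((hinteg t₀).const_mul θ)]
    refine integral_mono_ae ((hinteg t₁).sub ((hinteg t₀).const_mul θ)) (hshift.1.const_mul _) ?_
    have hne : ∀ᵐ s : ℝ, s ≠ t₀ := by simp [ae_iff]
    filter_upwards [hne] with s hs
    have hk1 := fracKernel_nonneg hα0 (t₁ - s)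
    have hk2 := fracKernel_nonneg one_pos (s - t₀)
    have hrhs : 0 ≤ r t₀ * (fracKernel α (t₁ - s) * fracKernel 1 (s - t₀)) := by positivity
    rcases le_or_gt s 0 with hs0 | hs0
    · simpa [r, mlKernel_of_nonpos hs0] using hrhs
    rcases lt_or_gt_of_ne hs with hlt | hgt
    · have h1 := fracKernel_sub_le hα0 hα1 hs0.le hlt ht₀1.le
      have h2 := (hr_pos s hs0 (hlt.trans ht₀1)).le
      have h3 := mul_le_mul_of_nonneg_right h1 h2
      linarith
    · rw [fracKernel_one_of_pos (sub_pos.2 hgt), mul_one,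
        fracKernel_of_nonpos (show t₀ - s ≤ 0 by linarith)]
      rcases le_or_gt t₁ s with h1 | h1
      · simp [fracKernel_of_nonpos (show t₁ - s ≤ 0 by linarith)]
      · have h2 : r s ≤ r t₀ := hmax ⟨ht₀.1.trans hgt.le, h1.le⟩
        have h3 := mul_le_mul_of_nonneg_left h2 hk1
        linarith
  have h1 := hr_eq t₁
  have h2 := hr_eq t₀
  have h3 := haK t₀ ⟨ht₀.1, ht₀1⟩
  rw [hr_zero, hkθ] at h1
  have h4 := mul_le_mul_of_nonneg_left hle hL
  have h5 := mul_lt_mul_of_pos_left h3 hrt₀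
  have h6 := mul_le_mul_of_nonneg_left hθ2 hrt₀.le
  have h7 : θ * r t₀ = θ * fracKernel α t₀ - L * (θ * ∫ x, fracKernel α (t₀ - x) * r x) := by
    rw [h2]
    ring
  linarith

lemma integrable_fracKernel_mul {α C : ℝ} (hα : 0 < α) {f : ℝ → ℝ} (hf : Measurable f)
    (hfC : ∀ s, |f s| ≤ C * fracKernel 1 s) (t : ℝ) :
    Integrable fun s => fracKernel α (t - s) * f s := by
  refine ((integrable_fracKernel_mul_fracKernel hα one_pos t).const_mul C).mono'
    (((measurable_fracKernel α).comp (measurable_const.sub measurable_id)).mul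
      hf).aestronglyMeasurable (ae_of_all _ fun s => ?_)
  have hk := fracKernel_nonneg hα (t - s)
  rw [norm_mul, Real.norm_of_nonneg hk, mul_left_comm]
  exact mul_le_mul_of_nonneg_left (hfC s) hk

lemma integrable_mlKernel_mul {α β C : ℝ} (hα : 0 < α) (hβ : 0 < β) {f : ℝ → ℝ}
    (hf : Measurable f) (hfC : ∀ s, |f s| ≤ C * fracKernel 1 s) (c t : ℝ) :
    Integrable fun s => mlKernel α c β (t - s) * f s := by
  refine ((integral_mlKernel_mul_fracKernel hα hβ one_pos |c| t).1.const_mul C).mono'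
    (((measurable_mlKernel hα hβ c).comp (measurable_const.sub measurable_id)).mul
      hf).aestronglyMeasurable (ae_of_all _ fun s => ?_)
  have h1 := abs_mlKernel_le hα hβ c (t - s)
  rw [norm_mul, mul_left_comm]
  exact mul_le_mul h1 (hfC s) (abs_nonneg _) ((abs_nonneg _).trans h1)

/-- Associativity of the convolution of the resolvent kernel, the fractional kernel and a
bounded function supported on the positive half-line. -/
lemma integral_mlKernel_mul_integral_fracKernel {α β γ C : ℝ} (hα : 0 < α) (hβ : 0 < β)
    (hγ : 0 < γ) {f : ℝ → ℝ} (hf : Measurable f) (hfC : ∀ s, |f s| ≤ C * fracKernel 1 s)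
    (c t : ℝ) :
    Integrable (fun s => mlKernel α c β (t - s) * ∫ x, fracKernel γ (s - x) * f x) ∧
      ∫ s, mlKernel α c β (t - s) * ∫ x, fracKernel γ (s - x) * f x =
        ∫ x, mlKernel α c (β + γ) (t - x) * f x := by
  set G : ℝ × ℝ → ℝ := fun p => mlKernel α c β (t - p.1) * (fracKernel γ (p.1 - p.2) * f p.2)
  have hGm : AEStronglyMeasurable G (volume.prod volume) := by
    refine Measurable.aestronglyMeasurable ?_
    exact ((measurable_mlKernel hα hβ c).comp (measurable_const.sub measurable_fst)).mul
      (((measurable_fracKernel γ).comp (measurable_fst.sub measurable_snd)).mul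
        (hf.comp measurable_snd))
  have hin := fun s => integrable_fracKernel_mul hγ hf hfC s
  have hG : Integrable G (volume.prod volume) := by
    rw [integrable_prod_iff hGm]
    refine ⟨ae_of_all _ fun s => (hin s).const_mul (mlKernel α c β (t - s)), ?_⟩
    refine ((integral_mlKernel_mul_fracKernel hα hβ (add_pos hγ one_pos) |c| t).1.const_mul
      C).mono' hGm.norm.integral_prod_right' (ae_of_all _ fun s => ?_)
    have h1 := abs_mlKernel_le hα hβ c (t - s)
    rw [Real.norm_of_nonneg (integral_nonneg fun _ => norm_nonneg _)]
    simp only [G, norm_mul, integral_const_mul]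
    rw [mul_left_comm, Real.norm_eq_abs]
    refine mul_le_mul h1 ?_ (integral_nonneg fun _ => by positivity) ((abs_nonneg _).trans h1)
    rw [← integral_fracKernel_mul_fracKernel hγ one_pos, ← integral_const_mul]
    refine integral_mono (by simpa only [norm_mul] using (hin s).norm)
      ((integrable_fracKernel_mul_fracKernel hγ one_pos s).const_mul C) fun x => ?_
    have hk := fracKernel_nonneg hγ (s - x)
    simp only [Real.norm_of_nonneg hk, Real.norm_eq_abs]
    rw [mul_left_comm]
    exact mul_le_mul_of_nonneg_left (hfC x) hk
  constructor
  · simpa only [G, integral_const_mul] using hG.integral_prod_left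
  · calc ∫ s, mlKernel α c β (t - s) * ∫ x, fracKernel γ (s - x) * f x
        = ∫ s, ∫ x, G (s, x) := by simp only [G, integral_const_mul]
      _ = ∫ x, ∫ s, G (s, x) := integral_integral_swap hG
      _ = ∫ x, mlKernel α c (β + γ) (t - x) * f x := by
        refine integral_congr_ae (ae_of_all _ fun x => ?_)
        simp only [G, ← mul_assoc]
        rw [integral_mul_const, ← (integral_mlKernel_mul_fracKernel hα hβ hγ c (t - x)).2,
          ← integral_sub_right_eq_self (fun s => mlKernel α c β (t - x - s) * fracKernel γ s) x]
        simp

/-- Variation of constants for the scalar fractional Volterra equation. -/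
lemma volterra_variation_of_constants {α L T C : ℝ} (hα : 0 < α) (hT : 0 < T) {f u : ℝ → ℝ}
    (hf : Measurable f) (hu : Measurable u) (hfC : ∀ s, |f s| ≤ C * fracKernel 1 s)
    (huC : ∀ s, |u s| ≤ C * fracKernel 1 s)
    (heq : ∀ t ∈ Ioc 0 T, u t = 1 + ∫ s, fracKernel α (t - s) * f s) :
    u T = mlKernel α (-L) 1 T + ∫ s, mlKernel α (-L) α (T - s) * (f s + L * u s) := by
  have hru := integrable_mlKernel_mul hα hα hu huC (-L) T
  have hrf := integrable_mlKernel_mul hα hα hf hfC (-L) T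
  have hrrf := integrable_mlKernel_mul hα (add_pos hα hα) hf hfC (-L) T
  have hassoc := integral_mlKernel_mul_integral_fracKernel hα hα hα hf hfC (-L) T
  have hone := integral_mlKernel_mul_fracKernel hα hα one_pos (-L) T
  have hu0 : ∀ s, s ≤ 0 → u s = 0 := fun s hs => by
    simpa [fracKernel_of_nonpos hs] using huC s
  have hf0 : ∀ s, s ≤ 0 → f s = 0 := fun s hs => by
    simpa [fracKernel_of_nonpos hs] using hfC s
  have hconv : ∫ s, mlKernel α (-L) α (T - s) * u s =
      mlKernel α (-L) (α + 1) T + ∫ s, mlKernel α (-L) (α + α) (T - s) * f s := by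
    rw [← hone.2, ← hassoc.2, ← integral_add hone.1 hassoc.1]
    refine integral_congr_ae (ae_of_all _ fun s => ?_)
    simp only [← mul_add]
    rcases le_or_gt T s with hs | hs
    · simp [mlKernel_of_nonpos (show T - s ≤ 0 by linarith)]
    congr 1
    rcases le_or_gt s 0 with hs0 | hs0
    · rw [hu0 s hs0, fracKernel_of_nonpos hs0, zero_add]
      refine (integral_eq_zero_of_ae (ae_of_all _ fun x => ?_)).symm
      rcases le_or_gt x 0 with hx | hx
      · simp [hf0 x hx]
      · simp [fracKernel_of_nonpos (show s - x ≤ 0 by linarith)]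
    · rw [heq s ⟨hs0, hs.le⟩, fracKernel_one_of_pos hs0]
  have hkf : ∫ s, fracKernel α (T - s) * f s = (∫ s, mlKernel α (-L) α (T - s) * f s) +
      L * ∫ s, mlKernel α (-L) (α + α) (T - s) * f s := by
    rw [← integral_const_mul, ← integral_add hrf (hrrf.const_mul L)]
    refine integral_congr_ae (ae_of_all _ fun s => ?_)
    simp only [mlKernel_eq_add hα hα (-L) (T - s)]
    ring
  have hsplit : ∫ s, mlKernel α (-L) α (T - s) * (f s + L * u s) =
      (∫ s, mlKernel α (-L) α (T - s) * f s) + L * ∫ s, mlKernel α (-L) α (T - s) * u s := by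
    rw [← integral_const_mul, ← integral_add hrf (hru.const_mul L)]
    refine integral_congr_ae (ae_of_all _ fun s => ?_)
    ring
  rw [hsplit, hconv, heq T ⟨hT, le_rfl⟩, hkf, mlKernel_eq_add hα one_pos,
    fracKernel_one_of_pos hT, add_comm 1 α]
  ring

lemma mlKernel_neg_one_pos {α L t : ℝ} (hα : α ∈ Ioo (0 : ℝ) 1) (hL : 0 ≤ L) (ht : 0 < t) :
    0 < mlKernel α (-L) 1 t := by
  have h := integral_mlKernel_mul_fracKernel hα.1 hα.1 (sub_pos.2 hα.2) (-L) t
  rw [add_sub_cancel] at h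
  have hr : ∀ s, 0 ≤ mlKernel α (-L) α s := fun s => by
    rcases le_or_gt s 0 with hs | hs
    · exact (mlKernel_of_nonpos hs).ge
    · exact (mlKernel_neg_pos hα.1 hα.2.le hL hs).le
  rw [← h.2, integral_pos_iff_support_of_nonneg
    (fun s => mul_nonneg (hr _) (fracKernel_nonneg (sub_pos.2 hα.2) s)) h.1]
  refine (by simpa using ht : 0 < volume (Ioo 0 t)).trans_le (measure_mono fun s hs => ?_)
  exact (mul_pos (mlKernel_neg_pos hα.1 hα.2.le hL (sub_pos.2 hs.2))
    (fracKernel_pos (sub_pos.2 hα.2) hs.1)).ne'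

lemma mlKernel_neg_one_le_one {α L t : ℝ} (hα : α ∈ Ioo (0 : ℝ) 1) (hL : 0 ≤ L) (ht : 0 < t) :
    mlKernel α (-L) 1 t ≤ 1 := by
  have hr : 0 ≤ mlKernel α (-L) (1 + α) t := by
    rw [add_comm, ← (integral_mlKernel_mul_fracKernel hα.1 hα.1 one_pos (-L) t).2]
    refine integral_nonneg fun s => mul_nonneg ?_ (fracKernel_nonneg one_pos s)
    rcases le_or_gt (t - s) 0 with hs | hs
    · exact (mlKernel_of_nonpos hs).ge
    · exact (mlKernel_neg_pos hα.1 hα.2.le hL hs).le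
  rw [mlKernel_eq_add hα.1 one_pos, fracKernel_one_of_pos ht]
  nlinarith

lemma fractionalIntegral_eq_integral_fracKernel {α T t : ℝ} (ht : t ∈ Ioc 0 T) (F : ℝ → ℝ) :
    1 / Real.Gamma α * ∫ s in (0 : ℝ)..t, (t - s) ^ (α - 1) * F s =
      ∫ s, fracKernel α (t - s) * (Ioc 0 T).indicator F s := by
  rw [intervalIntegral.integral_of_le ht.1.le, integral_Ioc_eq_integral_Ioo,
    ← integral_const_mul, ← integral_indicator measurableSet_Ioo]
  refine integral_congr_ae (ae_of_all _ fun s => ?_)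
  by_cases hs : s ∈ Ioo 0 t
  · have hs' : s ∈ Ioc 0 T := ⟨hs.1, hs.2.le.trans ht.2⟩
    simp only [indicator_of_mem hs, indicator_of_mem hs', fracKernel_of_pos (sub_pos.2 hs.2)]
    ring
  · rw [indicator_of_notMem hs]
    rcases le_or_gt s 0 with hs0 | hs0
    · simp [indicator, hs0.not_gt]
    · have : t ≤ s := not_lt.1 fun h => hs ⟨hs0, h⟩
      simp [fracKernel_of_nonpos (show t - s ≤ 0 by linarith)]

lemma measurable_indicator_Ioc {T : ℝ} {F : ℝ → ℝ} (hF : ContinuousOn F (Icc 0 T)) :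
    Measurable ((Ioc 0 T).indicator F) := by
  classical
  rw [← piecewise_eq_indicator]
  exact (hF.mono Ioc_subset_Icc_self).measurable_piecewise continuousOn_const measurableSet_Ioc

lemma abs_indicator_Ioc_le {T C : ℝ} {F : ℝ → ℝ} (hF : ∀ t ∈ Icc 0 T, |F t| ≤ C) (hC : 0 ≤ C)
    (s : ℝ) : |(Ioc 0 T).indicator F s| ≤ C * fracKernel 1 s := by
  by_cases hs : s ∈ Ioc 0 T
  · rw [indicator_of_mem hs, fracKernel_one_of_pos hs.1, mul_one]
    exact hF s ⟨hs.1.le, hs.2⟩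
  · rw [indicator_of_notMem hs, abs_zero]
    exact mul_nonneg hC (fracKernel_nonneg one_pos s)

/-- A solution of the scalar fractional Volterra equation with coefficient bounded by `L` is
bounded below by the solution for the constant coefficient `-L`. -/
lemma mittagLeffler_neg_le_of_volterra {α L T : ℝ} (hα : α ∈ Ioo (0 : ℝ) 1) (hL : 0 ≤ L)
    (hT : 0 < T) {h u : ℝ → ℝ} (hh : ContinuousOn h (Icc 0 T)) (hu : ContinuousOn u (Icc 0 T))
    (hhL : ∀ t ∈ Icc 0 T, |h t| ≤ L)
    (heq : ∀ t ∈ Icc 0 T, u t =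
      1 + 1 / Real.Gamma α * ∫ s in (0 : ℝ)..t, (t - s) ^ (α - 1) * (h s * u s)) :
    mittagLeffler α (-(L * T ^ α)) ≤ u T := by
  obtain ⟨B, hB⟩ := isCompact_Icc.exists_bound_of_continuousOn hu
  have hB0 : 0 ≤ B := (norm_nonneg _).trans (hB 0 ⟨le_rfl, hT.le⟩)
  have hC0 : 0 ≤ max B (L * B) := hB0.trans (le_max_left _ _)
  have huC := abs_indicator_Ioc_le (fun t ht => (hB t ht).trans (le_max_left B (L * B))) hC0
  have hfC := abs_indicator_Ioc_le (F := fun s => h s * u s) (fun t ht => by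
    rw [abs_mul]
    exact (mul_le_mul (hhL t ht) (hB t ht) (abs_nonneg _) hL).trans (le_max_right B (L * B))) hC0
  have hhu : ContinuousOn (fun s => h s * u s) (Icc 0 T) := hh.mul hu
  have hE : ∀ t ∈ Ioc 0 T, u t = mlKernel α (-L) 1 t + ∫ s, mlKernel α (-L) α (t - s) *
      ((Ioc 0 T).indicator (fun s => h s * u s) s + L * (Ioc 0 T).indicator u s) := by
    intro t ht
    rw [← volterra_variation_of_constants hα.1 ht.1 (measurable_indicator_Ioc hhu)
      (measurable_indicator_Ioc hu) hfC huC fun s hs => ?_, indicator_of_mem ht]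
    have hs' : s ∈ Ioc 0 T := ⟨hs.1, hs.2.trans ht.2⟩
    rw [indicator_of_mem hs', heq s ⟨hs'.1.le, hs'.2⟩,
      fractionalIntegral_eq_integral_fracKernel hs']
  have hlow : ∀ t ∈ Ioc 0 T, (∀ s ∈ Ico 0 t, 0 < u s) → mlKernel α (-L) 1 t ≤ u t := by
    intro t ht hpos
    rw [hE t ht]
    refine le_add_of_nonneg_right (integral_nonneg fun s => ?_)
    dsimp only [Pi.zero_apply]
    rcases le_or_gt t s with hs | hs
    · rw [mlKernel_of_nonpos (sub_nonpos.2 hs), zero_mul]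
    refine mul_nonneg (mlKernel_neg_pos hα.1 hα.2.le hL (sub_pos.2 hs)).le ?_
    by_cases hsT : s ∈ Ioc 0 T
    · rw [indicator_of_mem hsT, indicator_of_mem hsT, ← add_mul]
      exact mul_nonneg (by linarith [(abs_le.1 (hhL s ⟨hsT.1.le, hsT.2⟩)).1])
        (hpos s ⟨hsT.1.le, hs⟩).le
    · simp [indicator_of_notMem hsT]
  have hu0 : 0 < u 0 := by simp [heq 0 ⟨le_rfl, hT.le⟩]
  have hpos : ∀ t ∈ Icc 0 T, 0 < u t := by
    intro t ht
    by_contra hneg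
    obtain ⟨t₁, ht₁, hz, hp⟩ := exists_first_zero ht.1 (hu.mono (Icc_subset_Icc_right ht.2)) hu0
      (not_lt.1 hneg)
    have h1 := hlow t₁ ⟨ht₁.1, ht₁.2.trans ht.2⟩ hp
    have h2 := mlKernel_neg_one_pos hα hL ht₁.1
    linarith
  have := hlow T ⟨hT, le_rfl⟩ fun s hs => hpos s ⟨hs.1, hs.2.le⟩
  rwa [mlKernel_one_of_pos hT, neg_mul] at this

/-- Fractional Grönwall inequality. -/
lemma le_mittagLeffler_of_volterra {α L T : ℝ} (hα : 0 < α) (hL : 0 ≤ L) (hT : 0 < T)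
    {F : ℝ → ℝ} (hF : ContinuousOn F (Icc 0 T))
    (hle : ∀ t ∈ Icc 0 T, F t ≤
      1 + L * (1 / Real.Gamma α * ∫ s in (0 : ℝ)..t, (t - s) ^ (α - 1) * F s)) :
    F T ≤ mittagLeffler α (L * T ^ α) := by
  obtain ⟨B, hB⟩ := isCompact_Icc.exists_bound_of_continuousOn hF
  have hB0 : 0 ≤ B := (norm_nonneg _).trans (hB 0 ⟨le_rfl, hT.le⟩)
  have hk : ∀ n : ℕ, 0 < α * n + 1 := fun n => by positivity
  have hiter : ∀ N : ℕ, ∀ t ∈ Ioc 0 T,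
      F t ≤ (∑ n ∈ Finset.range N, L ^ n * fracKernel (α * n + 1) t) +
        B * (L ^ N * fracKernel (α * N + 1) t) := by
    intro N
    induction N with
    | zero =>
      intro t ht
      simpa [fracKernel_one_of_pos ht.1] using (le_abs_self _).trans (hB t ⟨ht.1.le, ht.2⟩)
    | succ N ih =>
      intro t ht
      have hterm := fun n : ℕ => integrable_fracKernel_mul_fracKernel hα (hk n) t
      have hbound : ∫ s, fracKernel α (t - s) * (Ioc 0 T).indicator F s ≤
          ∫ s, ((∑ n ∈ Finset.range N, L ^ n * (fracKernel α (t - s) * fracKernel (α * n + 1) s)) +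
            B * (L ^ N * (fracKernel α (t - s) * fracKernel (α * N + 1) s))) := by
        refine integral_mono (integrable_fracKernel_mul hα (measurable_indicator_Ioc hF)
          (abs_indicator_Ioc_le hB hB0) t) ((integrable_finsetSum _ fun n _ =>
          (hterm n).const_mul _).add (((hterm N).const_mul _).const_mul _)) fun s => ?_
        have hks := fracKernel_nonneg hα (t - s)
        have hR : (∑ n ∈ Finset.range N, L ^ n * (fracKernel α (t - s) *
              fracKernel (α * n + 1) s)) +
            B * (L ^ N * (fracKernel α (t - s) * fracKernel (α * N + 1) s)) =
            fracKernel α (t - s) * ((∑ n ∈ Finset.range N, L ^ n * fracKernel (α * n + 1) s) +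
              B * (L ^ N * fracKernel (α * N + 1) s)) := by
          rw [mul_add, Finset.mul_sum]
          congr 1
          · exact Finset.sum_congr rfl fun n _ => by ring
          · ring
        simp only [hR]
        refine mul_le_mul_of_nonneg_left ?_ hks
        by_cases hs : s ∈ Ioc 0 T
        · rw [indicator_of_mem hs]
          exact ih s hs
        · rw [indicator_of_notMem hs]
          exact add_nonneg (Finset.sum_nonneg fun n _ =>
            mul_nonneg (pow_nonneg hL n) (fracKernel_nonneg (hk n) s))
            (mul_nonneg hB0 (mul_nonneg (pow_nonneg hL N) (fracKernel_nonneg (hk N) s)))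
      rw [integral_add (integrable_finsetSum _ fun n _ => (hterm n).const_mul _)
        (((hterm N).const_mul _).const_mul _), integral_finsetSum _ fun n _ =>
        (hterm n).const_mul _] at hbound
      simp only [integral_const_mul, integral_fracKernel_mul_fracKernel hα (hk _)] at hbound
      have h1 := hle t ⟨ht.1.le, ht.2⟩
      rw [fractionalIntegral_eq_integral_fracKernel ht] at h1
      have h2 := mul_le_mul_of_nonneg_left hbound hL
      refine h1.trans ((add_le_add_right h2 1).trans (le_of_eq ?_))
      rw [Finset.sum_range_succ', mul_add, Finset.mul_sum]
      have hexp : ∀ n : ℕ, L * (L ^ n * fracKernel (α + (α * n + 1)) t) =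
          L ^ (n + 1) * fracKernel (α * ((n + 1 : ℕ) : ℝ) + 1) t := fun n => by
        rw [pow_succ']
        push_cast
        rw [show α + (α * (n : ℝ) + 1) = α * (n + 1) + 1 by ring, mul_assoc]
      simp only [hexp]
      rw [mul_left_comm L B, hexp]
      simp [fracKernel_one_of_pos ht.1]
      ring
  have hsum := hasSum_mlKernel hα one_pos L T
  have hlim := hsum.tendsto_sum_nat.add (hsum.summable.tendsto_atTop_zero.const_mul B)
  rw [mul_zero, add_zero, mlKernel_one_of_pos hT] at hlim
  exact ge_of_tendsto' hlim fun N => hiter N T ⟨hT, le_rfl⟩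

lemma intervalIntegrable_rpow_sub {α a t : ℝ} (hα : 0 < α) :
    IntervalIntegrable (fun s => (t - s) ^ (α - 1)) volume a t := by
  have h := (intervalIntegral.intervalIntegrable_rpow' (a := t - a) (b := 0)
    (show -1 < α - 1 by linarith)).comp_sub_left t
  simpa using h

lemma map_integral_rpow_sub_smul {V G : Type*} [NormedAddCommGroup V] [NormedSpace ℝ V]
    [CompleteSpace V] [NormedAddCommGroup G] [NormedSpace ℝ G] [CompleteSpace G] {α a t : ℝ}
    (hα : 0 < α) (hat : a ≤ t) {f : ℝ → V} (hf : ContinuousOn f (Icc a t)) (ℓ : V →L[ℝ] G) :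
    ℓ (∫ s in a..t, (t - s) ^ (α - 1) • f s) = ∫ s in a..t, (t - s) ^ (α - 1) • ℓ (f s) := by
  rw [← ContinuousLinearMap.intervalIntegral_comp_comm _
    ((intervalIntegrable_rpow_sub hα).smul_continuousOn (by rwa [uIcc_of_le hat]))]
  simp only [map_smul]

lemma map_volterra_solution {d : ℕ} {G : Type*} [NormedAddCommGroup G] [NormedSpace ℝ G]
    [CompleteSpace G] {α a b t : ℝ} (hα : 0 < α) {A : Matrix (Fin d) (Fin d) ℝ} {g : ℝ → ℝ}
    (hg : ContinuousOn g (Icc a b)) {Ψ : ℝ → Matrix (Fin d) (Fin d) ℝ}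
    (hΨc : ContinuousOn Ψ (Icc a b)) (ht : t ∈ Icc a b)
    (hΨ : Ψ t =
      1 + (1 / Real.Gamma α) • ∫ s in a..t, (t - s) ^ (α - 1) • (g s • (A * Ψ s)))
    (ℓ : Matrix (Fin d) (Fin d) ℝ →ₗ[ℝ] G) :
    ℓ (Ψ t) = ℓ 1 + (1 / Real.Gamma α) •
      ∫ s in a..t, (t - s) ^ (α - 1) • (g s • ℓ (A * Ψ s)) := by
  have hcont : ContinuousOn (fun s => g s • (A * Ψ s)) (Icc a t) :=
    (hg.smul (continuousOn_const.mul hΨc)).mono (Icc_subset_Icc_right ht.2)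
  have h : ℓ (∫ s in a..t, (t - s) ^ (α - 1) • (g s • (A * Ψ s))) =
      ∫ s in a..t, (t - s) ^ (α - 1) • ℓ (g s • (A * Ψ s)) :=
    map_integral_rpow_sub_smul (V := Matrix (Fin d) (Fin d) ℝ) hα ht.1 hcont
      (⟨ℓ, ℓ.continuous_of_finiteDimensional⟩ : Matrix (Fin d) (Fin d) ℝ →L[ℝ] G)
  conv_lhs => rw [hΨ]
  rw [map_add, LinearMap.map_smul, h]
  simp only [LinearMap.map_smul]

lemma inner_toEuclideanCLM_mul {d : ℕ} {A : Matrix (Fin d) (Fin d) ℝ} (hA : A.IsHermitian)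
    (X : Matrix (Fin d) (Fin d) ℝ) (i : Fin d) (y : EuclideanSpace ℝ (Fin d)) :
    inner ℝ (hA.eigenvectorBasis i) (Matrix.toEuclideanCLM (𝕜 := ℝ) (A * X) y) =
      hA.eigenvalues i * inner ℝ (hA.eigenvectorBasis i) (Matrix.toEuclideanCLM (𝕜 := ℝ) X y) := by
  rw [Matrix.inner_toEuclideanCLM, Matrix.inner_toEuclideanCLM, ← Matrix.mulVec_mulVec,
    Matrix.dotProduct_mulVec, ← Matrix.mulVec_transpose]
  have hT : Aᵀ = A := hA
  rw [hT, hA.mulVec_eigenvectorBasis, smul_dotProduct, smul_eq_mul]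

lemma norm_toEuclideanCLM_le {d : ℕ} {A : Matrix (Fin d) (Fin d) ℝ} (hA : A.IsHermitian)
    {l : ℝ} (hl0 : 0 ≤ l) (hl : ∀ i, |hA.eigenvalues i| ≤ l) :
    ‖Matrix.toEuclideanCLM (𝕜 := ℝ) A‖ ≤ l := by
  refine ContinuousLinearMap.opNorm_le_bound _ hl0 fun x => ?_
  refine (sq_le_sq₀ (norm_nonneg _) (by positivity)).1 ?_
  rw [mul_pow, ← hA.eigenvectorBasis.sum_sq_norm_inner_right,
    ← hA.eigenvectorBasis.sum_sq_norm_inner_right, Finset.mul_sum]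
  refine Finset.sum_le_sum fun i _ => ?_
  have h := inner_toEuclideanCLM_mul hA 1 i x
  rw [mul_one, map_one, one_apply_eq_self] at h
  rw [h, norm_mul, mul_pow]
  have := hl i
  rw [Real.norm_eq_abs]
  gcongr

/-- two-sided bounds
`E_α(-λ_max M (b-a)^α) ≤ ‖Ψ(t)‖ ≤ E_α(λ_max M (b-a)^α)` for the solution of
`Ψ(t) = 𝕀 + (1/Γ(α)) ∫_a^t (t-s)^{α-1} g(s) A Ψ(s) ds`, with `A` symmetric,
`λ_max = max_i |λ_i|` its largest eigenvalue in absolute value, and `|g| ≤ M`. -/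
theorem caputo_transition_matrix_bounds_symm
    (d : ℕ) (α a b M lmax : ℝ) (hα : α ∈ Set.Ioo (0:ℝ) 1) (hab : a < b)
    (A : Matrix (Fin d) (Fin d) ℝ) (hA : A.IsHermitian)
    (hlmax_mem : ∃ i, |hA.eigenvalues i| = lmax)
    (hlmax_max : ∀ i, |hA.eigenvalues i| ≤ lmax)
    (hM : 0 ≤ M) (g : ℝ → ℝ) (hg : ContinuousOn g (Set.Icc a b))
    (hgb : ∀ t ∈ Set.Icc a b, |g t| ≤ M)
    (Ψ : ℝ → Matrix (Fin d) (Fin d) ℝ) (hΨc : ContinuousOn Ψ (Set.Icc a b))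
    (hΨ : ∀ t ∈ Set.Icc a b,
      Ψ t = 1 + (1 / Real.Gamma α) • ∫ s in a..t, (t - s) ^ (α - 1) • (g s • (A * Ψ s))) :
    ∀ t ∈ Set.Icc a b,
      mittagLeffler α (-(lmax * M * (b - a) ^ α)) ≤ ‖Matrix.toEuclideanCLM (𝕜 := ℝ) (Ψ t)‖ ∧
      ‖Matrix.toEuclideanCLM (𝕜 := ℝ) (Ψ t)‖ ≤ mittagLeffler α (lmax * M * (b - a) ^ α) := by
  intro t ht
  obtain ⟨i, hi⟩ := hlmax_mem
  have hl0 : 0 ≤ lmax := hi ▸ abs_nonneg _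
  have hLM : 0 ≤ lmax * M := mul_nonneg hl0 hM
  have hba : 0 < b - a := sub_pos.2 hab
  have hG := Real.Gamma_pos_of_pos hα.1
  set v := hA.eigenvectorBasis i
  have hv : ‖v‖ = 1 := hA.eigenvectorBasis.orthonormal.1 i
  let ℓ : Matrix (Fin d) (Fin d) ℝ →ₗ[ℝ] ℝ :=
    { toFun := fun X => inner ℝ v (Matrix.toEuclideanCLM (𝕜 := ℝ) X v)
      map_add' := fun X Y => by simp [inner_add_right]
      map_smul' := fun r X => by simp [inner_smul_right] }
  let Φ : Matrix (Fin d) (Fin d) ℝ →ₗ[ℝ]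
      (EuclideanSpace ℝ (Fin d) →L[ℝ] EuclideanSpace ℝ (Fin d)) :=
    (Matrix.toEuclideanCLM (n := Fin d) (𝕜 := ℝ)).toAlgEquiv.toLinearMap
  have hΦ : ∀ X, Φ X = Matrix.toEuclideanCLM (𝕜 := ℝ) X := fun _ => rfl
  have hℓ1 : ℓ 1 = 1 := by
    simp [ℓ, hv]
  have hℓΦ : ∀ X, ℓ X ≤ ‖Matrix.toEuclideanCLM (𝕜 := ℝ) X‖ := fun X => by
    have h1 := real_inner_le_norm v (Matrix.toEuclideanCLM (𝕜 := ℝ) X v)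
    have h2 := (Matrix.toEuclideanCLM (𝕜 := ℝ) X).le_opNorm v
    rw [hv, mul_one] at h2
    rw [hv, one_mul] at h1
    exact h1.trans h2
  have hΦ1 : ‖Φ 1‖ ≤ 1 := by
    rw [hΦ, map_one]
    exact ContinuousLinearMap.norm_id_le
  have hℓc : ContinuousOn (fun s => ℓ (Ψ s)) (Icc a b) :=
    ℓ.continuous_of_finiteDimensional.comp_continuousOn hΨc
  have hΦc : ContinuousOn (fun s => Φ (Ψ s)) (Icc a b) :=
    Φ.continuous_of_finiteDimensional.comp_continuousOn hΨc
  rcases ht.1.eq_or_lt with rfl | hat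
  · have hΨa : Ψ a = 1 := by simpa using hΨ a ht
    have hpos := Real.rpow_pos_of_pos hba α
    constructor
    · refine le_trans ?_ (hℓΦ _)
      rw [hΨa, hℓ1, ← neg_mul, ← mlKernel_one_of_pos hba]
      exact mlKernel_neg_one_le_one hα hLM hba
    · rw [hΨa, ← hΦ]
      refine hΦ1.trans ?_
      rw [← mlKernel_one_of_pos hba, mlKernel_eq_add hα.1 one_pos, fracKernel_one_of_pos hba]
      have h := (abs_nonneg _).trans
        (abs_mlKernel_le hα.1 (add_pos one_pos hα.1) (lmax * M) (b - a))
      rw [abs_of_nonneg hLM] at h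
      exact le_add_of_nonneg_right (mul_nonneg hLM h)
  -- rescale the constant so that the bounds at the endpoint `t` become those for `[a, b]`
  set T := t - a
  have hT : 0 < T := sub_pos.2 hat
  set L := lmax * M * ((b - a) / T) ^ α with hLdef
  have hLT : L * T ^ α = lmax * M * (b - a) ^ α := by
    rw [hLdef, mul_assoc, ← Real.mul_rpow (by positivity) hT.le, div_mul_cancel₀ _ hT.ne']
  have hL : lmax * M ≤ L := by
    refine le_mul_of_one_le_right hLM (Real.one_le_rpow ?_ hα.1.le)
    rw [one_le_div hT]
    exact sub_le_sub_right ht.2 a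
  have hmaps : MapsTo (fun s => a + s) (Icc 0 T) (Icc a b) := fun s hs =>
    ⟨le_add_of_nonneg_right hs.1, by linarith [hs.2, ht.2, show T = t - a from rfl]⟩
  have hshift : ContinuousOn (fun s : ℝ => a + s) (Icc 0 T) := by fun_prop
  have haT : a + T = t := add_sub_cancel a t
  rw [← hLT]
  constructor
  · refine le_trans ?_ (hℓΦ _)
    rw [← haT]
    refine mittagLeffler_neg_le_of_volterra (h := fun s => g (a + s) * hA.eigenvalues i)
      (u := fun s => ℓ (Ψ (a + s))) hα (hLM.trans hL) hT
      ((hg.comp hshift hmaps).mul continuousOn_const) (hℓc.comp hshift hmaps)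
      (fun s hs => ?_) fun s hs => ?_
    · rw [abs_mul, hi, mul_comm]
      exact (mul_le_mul_of_nonneg_left (hgb _ (hmaps hs)) hl0).trans hL
    · rw [map_volterra_solution hα.1 hg hΨc (hmaps hs) (hΨ _ (hmaps hs)) ℓ, hℓ1, smul_eq_mul]
      have hsub := intervalIntegral.integral_comp_add_left (a := 0) (b := s)
        (fun x => (a + s - x) ^ (α - 1) • (g x • ℓ (A * Ψ x))) a
      rw [add_zero] at hsub
      rw [← hsub]
      congr 2
      refine intervalIntegral.integral_congr fun x _ => ?_
      have hmul : ℓ (A * Ψ (a + x)) = hA.eigenvalues i * ℓ (Ψ (a + x)) :=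
        inner_toEuclideanCLM_mul hA _ i _
      simp only [hmul, smul_eq_mul, add_sub_add_left_eq_sub]
      ring
  · rw [← haT]
    refine le_mittagLeffler_of_volterra (F := fun s => ‖Φ (Ψ (a + s))‖) hα.1 (hLM.trans hL) hT
      (hΦc.norm.comp hshift hmaps) fun s hs => ?_
    rw [map_volterra_solution hα.1 hg hΨc (hmaps hs) (hΨ _ (hmaps hs)) Φ]
    refine (norm_add_le _ _).trans (add_le_add hΦ1 ?_)
    have hsub := intervalIntegral.integral_comp_add_left (a := 0) (b := s)
      (fun x => (a + s - x) ^ (α - 1) • (g x • Φ (A * Ψ x))) a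
    rw [add_zero] at hsub
    rw [← hsub, norm_smul, Real.norm_of_nonneg (by positivity), mul_left_comm,
      ← intervalIntegral.integral_const_mul]
    refine mul_le_mul_of_nonneg_left ?_ (by positivity)
    refine intervalIntegral.norm_integral_le_of_norm_le hs.1 (ae_of_all _ fun x hx => ?_)
      (((intervalIntegrable_rpow_sub hα.1).mul_continuousOn ?_).const_mul L)
    · have hxT : x ∈ Icc 0 T := ⟨hx.1.le, hx.2.trans hs.2⟩
      have hk : 0 ≤ (s - x) ^ (α - 1) := Real.rpow_nonneg (sub_nonneg.2 hx.2) _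
      have hΦA : ‖Φ (A * Ψ (a + x))‖ ≤ lmax * ‖Φ (Ψ (a + x))‖ := by
        rw [hΦ, map_mul]
        exact (norm_mul_le _ _).trans
          (mul_le_mul_of_nonneg_right (norm_toEuclideanCLM_le hA hl0 hlmax_max) (norm_nonneg _))
      rw [add_sub_add_left_eq_sub, norm_smul, norm_smul, Real.norm_of_nonneg hk, mul_left_comm L]
      refine mul_le_mul_of_nonneg_left ?_ hk
      calc ‖g (a + x)‖ * ‖Φ (A * Ψ (a + x))‖ ≤ M * (lmax * ‖Φ (Ψ (a + x))‖) :=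
            mul_le_mul (hgb _ (hmaps hxT)) hΦA (norm_nonneg _) hM
        _ = lmax * M * ‖Φ (Ψ (a + x))‖ := by ring
        _ ≤ L * ‖Φ (Ψ (a + x))‖ := mul_le_mul_of_nonneg_right hL (norm_nonneg _)
    · rw [uIcc_of_le hs.1]
      exact (hΦc.norm.comp hshift hmaps).mono (Icc_subset_Icc_right hs.2)
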